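/- Let G be a finite simple graph, M a module of G, and S, S' independent sets of G with |S| = |S'|, M ∩ S = {u}, M ∩ S' = {v}, u ≠ v, and such that u and v lie in the same connected component of the induced subgraph G[M]. Then S ↭ S' in G (under token sliding) if and only if S ↭ (S' ∖ {v}) ∪ {u} in the induced subgraph G − v. -/

import Mathlib

open Finset

variable {V : Type*}

/-- `S` is an independent set of the simple graph `G`. -/
def IndepF (G : SimpleGraph V) (S : Finset V) : Prop :=
  ∀ u ∈ S, ∀ v ∈ S, ¬ G.Adj u v

/-- A single `TAR_k` step inside the induced subgraph `G[W]`: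
both sets are independent sets of `G` contained in `W`, their symmetric
difference has at most one element, and both have size at least `k`. -/
def TarStepOn [DecidableEq V] (G : SimpleGraph V) (W : Set V) (k : ℤ)
    (A B : Finset V) : Prop :=
  (A : Set V) ⊆ W ∧ (B : Set V) ⊆ W ∧ IndepF G A ∧ IndepF G B ∧
    (symmDiff A B).card ≤ 1 ∧ k ≤ (A.card : ℤ) ∧ k ≤ (B.card : ℤ)

/-- `TAR_k` reachability inside the induced subgraph `G[W]`. -/
def TarReachOn [DecidableEq V] (G : SimpleGraph V) (W : Set V) (k : ℤ) :
    Finset V → Finset V → Prop :=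
  Relation.ReflTransGen (TarStepOn G W k)

/-- A single token-sliding step inside the induced subgraph `G[W]`. -/
def TsStepOn [DecidableEq V] (G : SimpleGraph V) (W : Set V) (A B : Finset V) : Prop :=
  (A : Set V) ⊆ W ∧ (B : Set V) ⊆ W ∧ IndepF G A ∧ IndepF G B ∧
    ∃ x y, G.Adj x y ∧ symmDiff A B = {x, y}

/-- Token-sliding (`TS`) reachability inside the induced subgraph `G[W]`. -/
def TsReachOn [DecidableEq V] (G : SimpleGraph V) (W : Set V) :
    Finset V → Finset V → Prop :=
  Relation.ReflTransGen (TsStepOn G W)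

/-- `M` is a module of `G`. -/
def IsModule [DecidableEq V] (G : SimpleGraph V) (M : Finset V) : Prop :=
  ∀ u ∈ M, ∀ v ∈ M, ∀ w, w ∉ M → (G.Adj u w ↔ G.Adj v w)

/-- The open neighborhood `N(M)` of the vertex set `M`: vertices outside `M`
adjacent to some vertex of `M`. -/
def NbhdSet (G : SimpleGraph V) (M : Finset V) : Set V :=
  {w | w ∉ M ∧ ∃ v ∈ M, G.Adj v w}

/-- `lam G W S k` : the largest size of an independent set reachable from `S`
under `TAR_k` inside the induced subgraph `G[W]`. -/
noncomputable def lam [DecidableEq V] (G : SimpleGraph V) (W : Set V)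
    (S : Finset V) (k : ℤ) : ℕ :=
  sSup {n | ∃ T : Finset V, TarReachOn G W k S T ∧ T.card = n}

/-- A single token-jumping step: both sets are independent, of equal size,
and their symmetric difference has exactly two elements. -/
def TjStep [DecidableEq V] (G : SimpleGraph V) (A B : Finset V) : Prop :=
  IndepF G A ∧ IndepF G B ∧ A.card = B.card ∧ (symmDiff A B).card = 2

/-- Token-jumping (`TJ`) reachability. -/
def TjReach [DecidableEq V] (G : SimpleGraph V) : Finset V → Finset V → Prop :=
  Relation.ReflTransGen (TjStep G)

/-- A token-sliding step moves one token from some `x` to an adjacent `y`. -/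
theorem TsStepOn.exists_slide [DecidableEq V] {G : SimpleGraph V} {W : Set V} {A B : Finset V}
    (h : TsStepOn G W A B) :
    ∃ x y, G.Adj x y ∧ x ∈ A ∧ x ∉ B ∧ y ∈ B ∧ y ∉ A ∧
      ∀ z, z ≠ x → z ≠ y → (z ∈ A ↔ z ∈ B) := by
  obtain ⟨-, -, hA, hB, x, y, hxy, hd⟩ := h
  have key : ∀ z, (z ∈ A ∧ z ∉ B ∨ z ∈ B ∧ z ∉ A) ↔ z = x ∨ z = y := by
    intro z
    rw [← Finset.mem_symmDiff, hd]
    simp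
  have hyx := hxy.symm
  have hx := (key x).2 (Or.inl rfl)
  have hy := (key y).2 (Or.inr rfl)
  have hrest : ∀ z, z ≠ x → z ≠ y → (z ∈ A ↔ z ∈ B) := by
    intro z h1 h2
    have := key z
    tauto
  rcases hx with ⟨h1, h2⟩ | ⟨h1, h2⟩ <;> rcases hy with ⟨h3, h4⟩ | ⟨h3, h4⟩
  · exact absurd hxy (hA x h1 y h3)
  · exact ⟨x, y, hxy, h1, h2, h3, h4, hrest⟩
  · exact ⟨y, x, hyx, h3, h4, h1, h2, fun z h5 h6 => hrest z h6 h5⟩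
  · exact absurd hxy (hB x h1 y h3)

theorem symmDiff_eq_pair_of_slide [DecidableEq V] {A B : Finset V} {x y : V}
    (hxA : x ∈ A) (hxB : x ∉ B) (hyB : y ∈ B) (hyA : y ∉ A)
    (h : ∀ z, z ≠ x → z ≠ y → (z ∈ A ↔ z ∈ B)) : symmDiff A B = {x, y} := by
  ext z
  simp only [Finset.mem_symmDiff, Finset.mem_insert, Finset.mem_singleton]
  by_cases hzx : z = x
  · subst hzx; tauto
  · by_cases hzy : z = y
    · subst hzy; tauto
    · have := h z hzx hzy
      tauto

/-- Replace the tokens of `A` lying in `M`, if there are any, by a single token at `u`. -/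
def collapse [DecidableEq V] (M : Finset V) (u : V) (A : Finset V) : Finset V :=
  (A \ M) ∪ if (A ∩ M).Nonempty then {u} else ∅

theorem mem_collapse [DecidableEq V] {M : Finset V} {u : V} {A : Finset V} {z : V} :
    z ∈ collapse M u A ↔ (z ∈ A ∧ z ∉ M) ∨ (z = u ∧ ∃ a ∈ A, a ∈ M) := by
  unfold collapse
  split_ifs with h
  · have h' : ∃ a ∈ A, a ∈ M := by
      obtain ⟨a, ha⟩ := h
      exact ⟨a, (Finset.mem_inter.1 ha).1, (Finset.mem_inter.1 ha).2⟩
    simp [h', or_comm]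
  · have h' : ¬ ∃ a ∈ A, a ∈ M := by
      rintro ⟨a, ha, ha'⟩
      exact h ⟨a, Finset.mem_inter.2 ⟨ha, ha'⟩⟩
    simp [h']

theorem collapse_eq_of_inter_eq_singleton [DecidableEq V] {M : Finset V} {u w : V}
    {A : Finset V} (h : M ∩ A = {w}) : collapse M u A = (A \ {w}) ∪ {u} := by
  have key : ∀ z, (z ∈ M ∧ z ∈ A) ↔ z = w := by
    intro z
    rw [← Finset.mem_inter, h, Finset.mem_singleton]
  have hw := (key w).2 rfl
  ext z
  have hz := key z
  have hex : ∃ a ∈ A, a ∈ M := ⟨w, hw.2, hw.1⟩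
  simp only [mem_collapse, hex, and_true, Finset.mem_union, Finset.mem_sdiff,
    Finset.mem_singleton]
  tauto

theorem IndepF.collapse [DecidableEq V] {G : SimpleGraph V} {M : Finset V}
    (hM : IsModule G M) {u : V} (hu : u ∈ M) {A : Finset V} (hA : IndepF G A) :
    IndepF G (collapse M u A) := by
  intro x hx y hy hxy
  rw [mem_collapse] at hx hy
  rcases hx with ⟨hx, hxM⟩ | ⟨rfl, a, ha, haM⟩ <;> rcases hy with ⟨hy, hyM⟩ | ⟨rfl, b, hb, hbM⟩
  · exact hA x hx y hy hxy
  · exact hA b hb x hx ((hM y hu b hbM x hxM).1 hxy.symm)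
  · exact hA a ha y hy ((hM x hu a haM y hyM).1 hxy)
  · exact G.irrefl hxy

theorem collapse_subset_compl [DecidableEq V] {M : Finset V} {u v : V} (hv : v ∈ M)
    (huv : u ≠ v) (A : Finset V) : (collapse M u A : Set V) ⊆ {v}ᶜ := by
  intro z hz hzv
  rw [Set.mem_singleton_iff] at hzv
  subst hzv
  rw [Finset.mem_coe, mem_collapse] at hz
  rcases hz with hz | hz
  · exact hz.2 hv
  · exact huv hz.1.symm

/-- A token-sliding step cannot create a second token in a module. -/
theorem TsStepOn.subsingleton_inter [DecidableEq V] {G : SimpleGraph V} {W : Set V}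
    {M : Finset V} (hM : IsModule G M) {A B : Finset V} (h : TsStepOn G W A B)
    (hA : ∀ a ∈ A, a ∈ M → ∀ b ∈ A, b ∈ M → a = b) :
    ∀ a ∈ B, a ∈ M → ∀ b ∈ B, b ∈ M → a = b := by
  obtain ⟨x, y, hxy, hxA, hxB, hyB, hyA, hrest⟩ := h.exists_slide
  obtain ⟨-, -, hAi, -⟩ := h
  have old : ∀ c ∈ B, c ≠ y → c ∈ A := fun c hc hcy =>
    (hrest c (fun h => hxB (h ▸ hc)) hcy).2 hc
  have only : y ∈ M → ∀ c ∈ B, c ∈ M → c = y := by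
    intro hyM c hc hcM
    by_contra hcy
    have hcA := old c hc hcy
    by_cases hxM : x ∈ M
    · exact hxB (hA c hcA hcM x hxA hxM ▸ hc)
    · exact hAi c hcA x hxA ((hM y hyM c hcM x hxM).1 hxy.symm)
  intro a ha haM b hb hbM
  by_cases hay : a = y
  · subst hay
    exact (only haM b hb hbM).symm
  · by_cases hby : b = y
    · subst hby
      exact only hbM a ha haM
    · exact hA a (old a ha hay) haM b (old b hb hby) hbM

/-- Collapsing a module holding at most one token turns a step into a step or an equality. -/
theorem TsStepOn.collapse [DecidableEq V] {G : SimpleGraph V} {W : Set V}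
    {M : Finset V} (hM : IsModule G M) {u v : V} (hu : u ∈ M) (hv : v ∈ M) (huv : u ≠ v)
    {A B : Finset V} (h : TsStepOn G W A B)
    (hA : ∀ a ∈ A, a ∈ M → ∀ b ∈ A, b ∈ M → a = b) :
    collapse M u A = collapse M u B ∨
      TsStepOn G ({v}ᶜ : Set V) (collapse M u A) (collapse M u B) := by
  have hB := h.subsingleton_inter hM hA
  obtain ⟨x, y, hxy, hxA, hxB, hyB, hyA, hrest⟩ := h.exists_slide
  obtain ⟨-, -, hAi, hBi, -⟩ := h
  have build : ∀ x' y', G.Adj x' y' → symmDiff (_root_.collapse M u A) (_root_.collapse M u B)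
      = {x', y'} → TsStepOn G ({v}ᶜ : Set V) (_root_.collapse M u A) (_root_.collapse M u B) :=
    fun x' y' h1 h2 => ⟨collapse_subset_compl hv huv A, collapse_subset_compl hv huv B,
      hAi.collapse hM hu, hBi.collapse hM hu, x', y', h1, h2⟩
  by_cases hxM : x ∈ M <;> by_cases hyM : y ∈ M
  · left
    have hex : ∃ a ∈ A, a ∈ M := ⟨x, hxA, hxM⟩
    have hexB : ∃ a ∈ B, a ∈ M := ⟨y, hyB, hyM⟩
    ext z
    simp only [mem_collapse, hex, hexB, and_true]
    by_cases hzM : z ∈ M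
    · simp [hzM]
    · rw [hrest z (fun h => hzM (h ▸ hxM)) (fun h => hzM (h ▸ hyM))]
  · right
    have hex : ∃ a ∈ A, a ∈ M := ⟨x, hxA, hxM⟩
    have hexB : ¬ ∃ a ∈ B, a ∈ M := by
      rintro ⟨a, ha, haM⟩
      have hax : a ≠ x := fun h => hxB (h ▸ ha)
      have hay : a ≠ y := fun h => hyM (h ▸ haM)
      exact hax (hA a ((hrest a hax hay).2 ha) haM x hxA hxM)
    refine build u y ((hM x hxM u hu y hyM).1 hxy) ?_
    ext z
    simp only [Finset.mem_symmDiff, mem_collapse, hex, hexB, Finset.mem_insert,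
      Finset.mem_singleton, and_true, and_false, or_false]
    by_cases hzM : z ∈ M
    · have hzy : z ≠ y := fun h => hyM (h ▸ hzM)
      simp [hzM, hzy]
    · have hzu : z ≠ u := fun h => hzM (h ▸ hu)
      by_cases hzy : z = y
      · subst hzy
        simp [hzM, hyA, hyB, hzu]
      · have := hrest z (fun h => hzM (h ▸ hxM)) hzy
        simp [hzu, hzy, this]
  · right
    have hexB : ∃ a ∈ B, a ∈ M := ⟨y, hyB, hyM⟩
    have hex : ¬ ∃ a ∈ A, a ∈ M := by
      rintro ⟨a, ha, haM⟩
      have hay : a ≠ y := fun h => hyA (h ▸ ha)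
      have hax : a ≠ x := fun h => hxM (h ▸ haM)
      exact hay (hB a ((hrest a hax hay).1 ha) haM y hyB hyM)
    refine build x u ((hM y hyM u hu x hxM).1 hxy.symm).symm ?_
    ext z
    simp only [Finset.mem_symmDiff, mem_collapse, hex, hexB, Finset.mem_insert,
      Finset.mem_singleton, and_true, and_false, or_false]
    by_cases hzM : z ∈ M
    · have hzx : z ≠ x := fun h => hxM (h ▸ hzM)
      simp [hzM, hzx]
    · have hzu : z ≠ u := fun h => hzM (h ▸ hu)
      by_cases hzx : z = x
      · subst hzx
        simp [hzM, hxA, hxB, hzu]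
      · have := hrest z hzx (fun h => hzM (h ▸ hyM))
        simp [hzu, hzx, this]
  · right
    have hiff : (∃ a ∈ A, a ∈ M) ↔ ∃ a ∈ B, a ∈ M := by
      refine exists_congr fun a => ?_
      by_cases haM : a ∈ M
      · rw [hrest a (fun h => hxM (h ▸ haM)) (fun h => hyM (h ▸ haM))]
      · simp [haM]
    have hxu : x ≠ u := fun h => hxM (h ▸ hu)
    have hyu : y ≠ u := fun h => hyM (h ▸ hu)
    refine build x y hxy (symmDiff_eq_pair_of_slide ?_ ?_ ?_ ?_ ?_)
    · simp [mem_collapse, hxA, hxM]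
    · simp [mem_collapse, hxB, hxu]
    · simp [mem_collapse, hyB, hyM]
    · simp [mem_collapse, hyA, hyu]
    · intro z hzx hzy
      rw [mem_collapse, mem_collapse, hiff, hrest z hzx hzy]

theorem TsReachOn.collapse [DecidableEq V] {G : SimpleGraph V} {W : Set V}
    {M : Finset V} (hM : IsModule G M) {u v : V} (hu : u ∈ M) (hv : v ∈ M) (huv : u ≠ v)
    {A B : Finset V} (h : TsReachOn G W A B)
    (hA : ∀ a ∈ A, a ∈ M → ∀ b ∈ A, b ∈ M → a = b) :
    TsReachOn G ({v}ᶜ : Set V) (collapse M u A) (collapse M u B) := by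
  have key : (∀ a ∈ B, a ∈ M → ∀ b ∈ B, b ∈ M → a = b) ∧
      TsReachOn G ({v}ᶜ : Set V) (_root_.collapse M u A) (_root_.collapse M u B) := by
    induction h with
    | refl => exact ⟨hA, Relation.ReflTransGen.refl⟩
    | tail _ hstep ih =>
      refine ⟨hstep.subsingleton_inter hM ih.1, ?_⟩
      rcases hstep.collapse hM hu hv huv ih.1 with heq | hs
      · rw [← heq]
        exact ih.2
      · exact Relation.ReflTransGen.tail ih.2 hs
  exact key.2

theorem TsReachOn.mono [DecidableEq V] {G : SimpleGraph V} {W W' : Set V} (hW : W ⊆ W')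
    {A B : Finset V} (h : TsReachOn G W A B) : TsReachOn G W' A B :=
  Relation.ReflTransGen.mono
    (fun _ _ hs => ⟨hs.1.trans hW, hs.2.1.trans hW, hs.2.2⟩) _ _ h

/-- A single token of a module can slide along a path inside the module. -/
theorem tsReachOn_of_reachable_induce [DecidableEq V] {G : SimpleGraph V} {M : Finset V}
    (T : Finset V) (hTM : Disjoint T M) (hT : ∀ w ∈ M, IndepF G (T ∪ {w}))
    {a b : {x : V | x ∈ M}} (h : (G.induce {x : V | x ∈ M}).Reachable a b) :
    TsReachOn G Set.univ (T ∪ {a.1}) (T ∪ {b.1}) := by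
  rw [SimpleGraph.reachable_iff_reflTransGen] at h
  refine Relation.ReflTransGen.lift (fun c : {x : V | x ∈ M} => T ∪ {c.1}) ?_ _ _ h
  intro c d hcd
  have hadj : G.Adj c.1 d.1 := hcd
  have hcT : c.1 ∉ T := fun h => Finset.disjoint_left.1 hTM h c.2
  have hdT : d.1 ∉ T := fun h => Finset.disjoint_left.1 hTM h d.2
  refine ⟨Set.subset_univ _, Set.subset_univ _, hT _ c.2, hT _ d.2, c.1, d.1, hadj,
    symmDiff_eq_pair_of_slide ?_ ?_ ?_ ?_ ?_⟩
  · simp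
  · simp [hcT, hadj.ne]
  · simp
  · simp [hdT, hadj.ne']
  · intro z hzc hzd
    simp [hzc, hzd]

/-- Let `M` be a module of `G` and `S, S'` independent sets of
`G` with `|S| = |S'|`, `M ∩ S = {u}`, `M ∩ S' = {v}`, `u ≠ v`, and `u`, `v`
in the same connected component of `G[M]`. Then `S ↭ S'` in `G` under token
sliding iff `S ↭ (S' \ {v}) ∪ {u}` in `G - v`. -/
theorem stmt10 {V : Type*} [Fintype V] [DecidableEq V] (G : SimpleGraph V)
    (M : Finset V) (hM : IsModule G M)
    (S S' : Finset V) (hS : IndepF G S) (hS' : IndepF G S')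
    (hcard : S.card = S'.card)
    (u v : V) (huM : u ∈ M) (hvM : v ∈ M)
    (hSu : M ∩ S = {u}) (hS'v : M ∩ S' = {v}) (huv : u ≠ v)
    (hcomp : (G.induce {x : V | x ∈ M}).Reachable ⟨u, huM⟩ ⟨v, hvM⟩) :
    TsReachOn G Set.univ S S' ↔
      TsReachOn G ({v}ᶜ : Set V) S ((S' \ {v}) ∪ {u}) := by
  have hS1 : collapse M u S = S := by
    have huS : u ∈ S := (Finset.mem_inter.1 (hSu ▸ Finset.mem_singleton_self u)).2
    rw [collapse_eq_of_inter_eq_singleton hSu]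
    exact Finset.sdiff_union_of_subset (Finset.singleton_subset_iff.2 huS)
  constructor
  · intro h
    have hone : ∀ a ∈ S, a ∈ M → a = u := fun a ha haM =>
      Finset.mem_singleton.1 (hSu ▸ Finset.mem_inter.2 ⟨haM, ha⟩)
    have := h.collapse hM huM hvM huv fun a ha haM b hb hbM =>
      (hone a ha haM).trans (hone b hb hbM).symm
    rwa [hS1, collapse_eq_of_inter_eq_singleton hS'v] at this
  · intro h
    have hvS' : v ∈ S' := (Finset.mem_inter.1 (hS'v ▸ Finset.mem_singleton_self v)).2
    have hdisj : Disjoint (S' \ {v}) M := by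
      rw [Finset.disjoint_left]
      intro z hz hzM
      rw [Finset.mem_sdiff] at hz
      exact hz.2 (hS'v ▸ Finset.mem_inter.2 ⟨hzM, hz.1⟩)
    have hind : ∀ w ∈ M, IndepF G ((S' \ {v}) ∪ {w}) := by
      intro w hw
      rw [← collapse_eq_of_inter_eq_singleton hS'v]
      exact hS'.collapse hM hw
    have hslide := tsReachOn_of_reachable_induce (S' \ {v}) hdisj hind hcomp
    rw [Finset.sdiff_union_of_subset (Finset.singleton_subset_iff.2 hvS')] at hslide
    exact Relation.ReflTransGen.trans (h.mono (Set.subset_univ _)) hslide
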